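/- For every finitely generated group G there exists a finitely generated group H with G ≤ H ≤ Sym(G × ℤ) (G × ℤ embedded via left translations, G the first factor) such that: the natural action of H on G × ℤ is faithful and k-transitive for every k ∈ ℕ; there is a locally finite normal subgroup N of H with H/N isomorphic to G × ℤ; and H intersects the group Sym_f(G × ℤ) of finitely supported permutations trivially, i.e. H ∩ Sym_f(G × ℤ) = {1}. -/

import Mathlib

/-- A group is locally finite if each of its finitely generated subgroups is finite. -/
def IsLocallyFinite (N : Type*) [Group N] : Prop :=
  ∀ K : Subgroup N, K.FG → Finite K

/-- The action of a group `H` on `Ω` via `ρ : H →* Equiv.Perm Ω` is `k`-transitive: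
`Ω` has at least `k` points, and any `k`-tuple of pairwise distinct points can be carried
to any other. -/
def IsKTransitive {H : Type*} [Group H] {Ω : Type*} (ρ : H →* Equiv.Perm Ω) (k : ℕ) :
    Prop :=
  Nonempty (Fin k ↪ Ω) ∧ ∀ x y : Fin k ↪ Ω, ∃ h : H, ∀ i : Fin k, ρ h (x i) = y i

/-- The even integers `b` all of whose residues `b % 4 ^ j` are at most half the modulus. -/
def sparseInts : Set ℤ :=
  {b | Even b ∧ ∀ j : ℕ, 2 * (b % 4 ^ j) ≤ 4 ^ j}

theorem eventually_lt_four_pow (m : ℤ) : ∀ᶠ n : ℕ in Filter.atTop, m < 4 ^ n :=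
  (tendsto_pow_atTop_atTop_of_one_lt (by norm_num : (1 : ℤ) < 4)).eventually_gt_atTop m

theorem nonneg_of_mem_sparseInts {b : ℤ} (hb : b ∈ sparseInts) : 0 ≤ b := by
  by_contra! hneg
  obtain ⟨j, hj⟩ := (eventually_lt_four_pow (2 * -b)).exists
  have h := hb.2 j
  rw [← Int.add_emod_right, Int.emod_eq_of_lt (by omega) (by omega)] at h
  omega

theorem two_mul_four_pow_mem_sparseInts (n : ℕ) : 2 * 4 ^ n ∈ sparseInts := by
  refine ⟨even_two_mul _, fun j ↦ ?_⟩
  rcases le_or_gt j n with h | h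
  · rw [Int.emod_eq_zero_of_dvd ((pow_dvd_pow 4 h).mul_left 2)]
    positivity
  · have h1 : (4 : ℤ) ^ (n + 1) ≤ 4 ^ j := pow_le_pow_right₀ (by norm_num) h
    have h2 : (0 : ℤ) < 4 ^ n := by positivity
    rw [pow_succ] at h1
    rw [Int.emod_eq_of_lt (by omega) (by omega)]
    omega

/-- The points `2 * 4 ^ n` are more and more isolated in `sparseInts`. -/
theorem eventually_add_two_mul_four_pow_notMem {m : ℤ} (hm : m ≠ 0) :
    ∀ᶠ n : ℕ in Filter.atTop, m + 2 * 4 ^ n ∉ sparseInts := by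
  filter_upwards [eventually_lt_four_pow (2 * |m|)] with n hn hmem
  rcases hm.lt_or_gt with h | h
  · rw [abs_of_neg h] at hn
    have h1 := hmem.2 n
    rw [show m + 2 * 4 ^ n = (m + 4 ^ n) + 4 ^ n by ring, Int.add_emod_right,
      Int.emod_eq_of_lt (by omega) (by omega)] at h1
    omega
  · rw [abs_of_pos h] at hn
    have h1 := hmem.2 (n + 1)
    rw [pow_succ, Int.emod_eq_of_lt (by omega) (by omega)] at h1
    omega

/-- Every finite pattern of `sparseInts` recurs infinitely often. -/
theorem eventually_add_four_pow_mem_iff (m : ℤ) :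
    ∀ᶠ n : ℕ in Filter.atTop, (m + 4 ^ n ∈ sparseInts ↔ m ∈ sparseInts) := by
  filter_upwards [eventually_lt_four_pow (2 * |m|), Filter.eventually_ge_atTop 1] with n hn hn1
  have heven : Even ((4 : ℤ) ^ n) := (by decide : Even (4 : ℤ)).pow_of_ne_zero (by omega)
  have hlow : ∀ j ≤ n, (m + 4 ^ n) % 4 ^ j = m % 4 ^ j := fun j hj ↦ by
    rw [Int.add_emod, Int.emod_eq_zero_of_dvd (pow_dvd_pow 4 hj), add_zero, Int.emod_emod]
  have hm : m + 4 ^ n ∈ sparseInts ∨ m ∈ sparseInts → 0 ≤ m := by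
    rintro (h | h)
    · by_contra! hneg
      rw [abs_of_neg hneg] at hn
      have h1 := h.2 n
      rw [Int.add_emod_right, ← Int.add_emod_right, Int.emod_eq_of_lt (by omega) (by omega)] at h1
      omega
    · exact nonneg_of_mem_sparseInts h
  have hiff : 0 ≤ m → ∀ j, (2 * ((m + 4 ^ n) % 4 ^ j) ≤ 4 ^ j ↔ 2 * (m % 4 ^ j) ≤ 4 ^ j) := by
    intro hm0 j
    rcases le_or_gt j n with h | h
    · rw [hlow j h]
    · have h1 : (4 : ℤ) ^ (n + 1) ≤ 4 ^ j := pow_le_pow_right₀ (by norm_num) h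
      rw [abs_of_nonneg hm0] at hn
      rw [pow_succ] at h1
      rw [Int.emod_eq_of_lt (by omega) (by omega), Int.emod_eq_of_lt (by omega) (by omega)]
      omega
  constructor
  · intro h
    have hm0 := hm (.inl h)
    exact ⟨by simpa [Int.even_add, heven] using h.1, fun j ↦ (hiff hm0 j).1 (h.2 j)⟩
  · intro h
    have hm0 := hm (.inr h)
    exact ⟨h.1.add heven, fun j ↦ (hiff hm0 j).2 (h.2 j)⟩

/-- Points of `sparseInts` at bounded distance lie in the same block of length `4 ^ j`. -/
theorem exists_ediv_eq_of_abs_sub_le (R : ℤ) :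
    ∃ j : ℕ, ∀ b ∈ sparseInts, ∀ c ∈ sparseInts, |b - c| ≤ R → b / 4 ^ j = c / 4 ^ j := by
  obtain ⟨j, hj⟩ := (eventually_lt_four_pow (2 * R)).exists
  refine ⟨j, fun b hb c hc h ↦ ?_⟩
  have hb' := hb.2 j
  have hc' := hc.2 j
  have hpos : (0 : ℤ) < 4 ^ j := by positivity
  have hb0 := Int.emod_nonneg b hpos.ne'
  have hc0 := Int.emod_nonneg c hpos.ne'
  have hbd := Int.emod_add_mul_ediv b (4 ^ j)
  have hcd := Int.emod_add_mul_ediv c (4 ^ j)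
  rw [abs_le] at h
  generalize (4 : ℤ) ^ j = q at *
  rcases lt_trichotomy (b / q) (c / q) with h1 | h1 | h1
  · nlinarith
  · exact h1
  · nlinarith

/-- A finitely generated group acting faithfully with all orbits of bounded size is finite. -/
theorem finite_of_orbit_embeds {K X E : Type*} [Group K] [Group.FG K] [MulAction K X]
    [FaithfulSMul K X] [Finite E] (ι : ∀ x : X, MulAction.orbit K x ↪ E) : Finite K := by
  obtain ⟨T, hT⟩ := Group.fg_def.1 ‹Group.FG K›
  have : Finite (K →* Equiv.Perm E) := by
    refine Finite.of_injective (fun (f : K →* Equiv.Perm E) (t : T) ↦ f t) fun f g hfg ↦ ?_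
    exact MonoidHom.eq_of_eqOn_dense hT fun t ht ↦ congrFun hfg ⟨t, ht⟩
  let ρ (x : X) : K →* Equiv.Perm E :=
    (Equiv.Perm.viaEmbeddingHom (ι x)).comp (MulAction.toPermHom K (MulAction.orbit K x))
  refine Finite.of_injective (fun (k : K) (f : K →* Equiv.Perm E) ↦ f k) fun k l hkl ↦ ?_
  refine FaithfulSMul.eq_of_smul_eq_smul (α := X) fun x ↦ ?_
  have h1 := Equiv.Perm.viaEmbeddingHom_injective (ι x) (congrFun hkl (ρ x))
  have h2 := Equiv.congr_fun h1 ⟨x, MulAction.mem_orbit_self x⟩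
  exact congrArg Subtype.val h2

/-- The permutations agreeing with elements of `H` on every finite set. -/
def pointwiseClosure {X : Type*} (H : Subgroup (Equiv.Perm X)) : Subgroup (Equiv.Perm X) where
  carrier := {π | ∀ K : Set X, K.Finite → ∃ h ∈ H, ∀ z ∈ K, h z = π z}
  one_mem' _ _ := ⟨1, H.one_mem, fun _ _ ↦ rfl⟩
  mul_mem' {a b} ha hb K hK := by
    obtain ⟨h, hh, hb'⟩ := hb K hK
    obtain ⟨g, hg, ha'⟩ := ha (b '' K) (hK.image _)
    refine ⟨g * h, H.mul_mem hg hh, fun z hz ↦ ?_⟩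
    rw [Equiv.Perm.mul_apply, hb' z hz, ha' _ (Set.mem_image_of_mem _ hz), Equiv.Perm.mul_apply]
  inv_mem' {a} ha K hK := by
    obtain ⟨g, hg, ha'⟩ := ha (⇑a⁻¹ '' K) (hK.image _)
    refine ⟨g⁻¹, H.inv_mem hg, fun z hz ↦ ?_⟩
    rw [Equiv.Perm.inv_eq_iff_eq, ha' _ (Set.mem_image_of_mem _ hz), Equiv.Perm.coe_inv,
      Equiv.apply_symm_apply]

theorem isKTransitive_of_swap_mem {X : Type*} [Infinite X] [DecidableEq X]
    {H : Subgroup (Equiv.Perm X)} (hH : ∀ x y, Equiv.swap x y ∈ pointwiseClosure H) (k : ℕ) :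
    IsKTransitive H.subtype k := by
  refine ⟨⟨(Fin.valEmbedding).trans (Infinite.natEmbedding X)⟩, ?_⟩
  induction k with
  | zero => exact fun _ _ ↦ ⟨1, fun i ↦ i.elim0⟩
  | succ k ih =>
    intro x y
    obtain ⟨h, hh⟩ := ih (Fin.castSuccEmb.trans x) (Fin.castSuccEmb.trans y)
    simp only [Subgroup.subtype_apply, Function.Embedding.trans_apply,
      Fin.castSuccEmb_apply] at hh
    obtain ⟨g, hg, hg'⟩ := hH (h.1 (x (Fin.last k))) (y (Fin.last k))
      (Set.range fun i ↦ h.1 (x i)) (Set.finite_range _)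
    refine ⟨⟨g, hg⟩ * h, fun i ↦ ?_⟩
    simp only [Subgroup.subtype_apply, Subgroup.coe_mul, Equiv.Perm.mul_apply]
    rw [hg' _ (Set.mem_range_self i)]
    induction i using Fin.lastCases with
    | last => exact Equiv.swap_apply_left _ _
    | cast i =>
      rw [Equiv.swap_apply_of_ne_of_ne, hh]
      · exact (h.1.injective.comp x.injective).ne (Fin.castSucc_lt_last i).ne
      · rw [hh]
        exact y.injective.ne (Fin.castSucc_lt_last i).ne

theorem swap_mem_of_swap_mul_mem {Γ : Type*} [Group Γ] [DecidableEq Γ] {T : Set Γ}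
    (hT : Subgroup.closure T = ⊤) (D : Subgroup (Equiv.Perm Γ))
    (hD : ∀ s ∈ T, ∀ x, Equiv.swap x (x * s) ∈ D) (x y : Γ) : Equiv.swap x y ∈ D := by
  have key : ∀ s ∈ Subgroup.closure T, ∀ x, Equiv.swap x (x * s) ∈ D := by
    intro s hs
    induction hs using Subgroup.closure_induction with
    | mem s hs => exact hD s hs
    | one => simp [← Equiv.Perm.one_def, D.one_mem]
    | mul s t _ _ hs ht =>
      intro x
      rw [← mul_assoc]
      exact SubmonoidClass.swap_mem_trans _ (hs x) (ht (x * s))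
    | inv s _ hs =>
      intro x
      rw [Equiv.swap_comm]
      simpa using hs (x * s⁻¹)
  simpa using key (x⁻¹ * y) (by simp [hT]) x

section

variable {G : Type*} [Group G]

/-- The copy of `sparseInts` in the central factor of `G × ℤ`. -/
def sparseSet (G : Type*) [Group G] : Set (G × Multiplicative ℤ) :=
  {x | x.1 = 1 ∧ x.2.toAdd ∈ sparseInts}

/-- The central element `m` of `G × ℤ`. -/
def shift (G : Type*) [Group G] (m : ℤ) : G × Multiplicative ℤ :=
  (1, Multiplicative.ofAdd m)

theorem mul_shift_comm (x : G × Multiplicative ℤ) (m : ℤ) : x * shift G m = shift G m * x := by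
  ext <;> simp [shift, mul_comm]

theorem mul_shift_mem_sparseSet_iff (x : G × Multiplicative ℤ) (m : ℤ) :
    x * shift G m ∈ sparseSet G ↔ x.1 = 1 ∧ x.2.toAdd + m ∈ sparseInts := by
  simp [sparseSet, shift]

theorem eventually_mul_shift_notMem {x : G × Multiplicative ℤ} (hx : x ≠ 1) :
    ∀ᶠ n : ℕ in Filter.atTop, x * shift G (2 * 4 ^ n) ∉ sparseSet G := by
  simp only [mul_shift_mem_sparseSet_iff]
  by_cases h : x.1 = 1
  · have h2 : x.2.toAdd ≠ 0 := fun h0 ↦ hx (Prod.ext h h0)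
    filter_upwards [eventually_add_two_mul_four_pow_notMem h2] with n hn
    exact fun h ↦ hn h.2
  · simp [h]

theorem eventually_mul_shift_mem_iff (x : G × Multiplicative ℤ) :
    ∀ᶠ n : ℕ in Filter.atTop, (x * shift G (4 ^ n) ∈ sparseSet G ↔ x ∈ sparseSet G) := by
  filter_upwards [eventually_add_four_pow_mem_iff x.2.toAdd] with n hn
  rw [mul_shift_mem_sparseSet_iff, hn]
  rfl

theorem oddShift_mul_notMem_sparseSet (g : G) {x : G × Multiplicative ℤ} (hx : x ∈ sparseSet G) :
    (g, Multiplicative.ofAdd 1) * x ∉ sparseSet G := by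
  intro h
  have h1 := h.2.1
  have h2 := hx.2.1
  simp only [Prod.snd_mul, toAdd_mul, toAdd_ofAdd] at h1
  grind

open Classical in
/-- The product of the disjoint transpositions of `b` and `(g, 1) * b`, for `b` in
`sparseSet G`. -/
noncomputable def pairSwap (g : G) : Equiv.Perm (G × Multiplicative ℤ) :=
  Function.Involutive.toPerm
    (fun x ↦ if x ∈ sparseSet G then (g, Multiplicative.ofAdd 1) * x
      else if (g, Multiplicative.ofAdd 1)⁻¹ * x ∈ sparseSet G then (g, Multiplicative.ofAdd 1)⁻¹ * x
      else x)
    (fun x ↦ by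
      by_cases h : x ∈ sparseSet G
      · simp only [h, if_true, oddShift_mul_notMem_sparseSet g h, if_false, inv_mul_cancel_left]
      · by_cases h' : (g, Multiplicative.ofAdd 1)⁻¹ * x ∈ sparseSet G
        · simp only [h, h', if_true, if_false, mul_inv_cancel_left]
        · simp only [h, h', if_false])

theorem pairSwap_apply_of_mem (g : G) {x : G × Multiplicative ℤ} (hx : x ∈ sparseSet G) :
    pairSwap g x = (g, Multiplicative.ofAdd 1) * x :=
  if_pos hx

theorem pairSwap_apply_of_inv_mul_mem (g : G) {x : G × Multiplicative ℤ}
    (hx : (g, Multiplicative.ofAdd 1)⁻¹ * x ∈ sparseSet G) :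
    pairSwap g x = (g, Multiplicative.ofAdd 1)⁻¹ * x :=
  (if_neg fun h ↦ oddShift_mul_notMem_sparseSet g hx (by rwa [mul_inv_cancel_left])).trans
    (if_pos hx)

theorem pairSwap_apply_of_notMem (g : G) {x : G × Multiplicative ℤ} (hx : x ∉ sparseSet G)
    (hx' : (g, Multiplicative.ofAdd 1)⁻¹ * x ∉ sparseSet G) : pairSwap g x = x :=
  (if_neg hx).trans (if_neg hx')

/-- The pairs `(h, γ)` such that `h` is the left translation by `γ` outside finitely many
translates of `sparseSet G`. -/
def nearTranslations (G : Type*) [Group G] :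
    Subgroup (Equiv.Perm (G × Multiplicative ℤ) × (G × Multiplicative ℤ)) where
  carrier := {p | ∃ F : Set (G × Multiplicative ℤ), F.Finite ∧
    ∀ x, p.1 x ≠ p.2 * x → ∃ f ∈ F, f⁻¹ * x ∈ sparseSet G}
  one_mem' := ⟨∅, Set.finite_empty, fun x hx ↦ (hx (by simp)).elim⟩
  mul_mem' {p q} := by
    rintro ⟨F, hF, hp⟩ ⟨F', hF', hq⟩
    refine ⟨F' ∪ (q.2⁻¹ * ·) '' F, hF'.union (hF.image _), fun x hx ↦ ?_⟩
    by_cases h : q.1 x = q.2 * x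
    · obtain ⟨f, hf, hfx⟩ := hp (q.2 * x) (by simpa [h, mul_assoc] using hx)
      exact ⟨q.2⁻¹ * f, .inr ⟨f, hf, rfl⟩, by simpa [mul_assoc] using hfx⟩
    · obtain ⟨f, hf, hfx⟩ := hq x h
      exact ⟨f, .inl hf, hfx⟩
  inv_mem' {p} := by
    rintro ⟨F, hF, hp⟩
    refine ⟨(p.2 * ·) '' F, hF.image _, fun x hx ↦ ?_⟩
    obtain ⟨f, hf, hfx⟩ := hp (p.2⁻¹ * x) fun h ↦ hx <| by
      rw [mul_inv_cancel_left] at h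
      exact Equiv.Perm.inv_eq_iff_eq.2 h.symm
    exact ⟨p.2 * f, ⟨f, hf, rfl⟩, by simpa [mul_assoc] using hfx⟩

/-- The permutations moving every point by one of finitely many left translations. -/
def boundedDisplacement (Γ : Type*) [Group Γ] : Subgroup (Equiv.Perm Γ) where
  carrier := {h | ∃ E : Set Γ, E.Finite ∧ ∀ x, h x * x⁻¹ ∈ E}
  one_mem' := ⟨{1}, Set.finite_singleton _, fun x ↦ by simp⟩
  mul_mem' {a b} := by
    rintro ⟨E, hE, ha⟩ ⟨E', hE', hb⟩
    refine ⟨Set.image2 (· * ·) E E', hE.image2 _ hE', fun x ↦ ⟨_, ha (b x), _, hb x, ?_⟩⟩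
    simp
  inv_mem' {a} := by
    rintro ⟨E, hE, ha⟩
    refine ⟨(·⁻¹) '' E, hE.image _, fun x ↦ ⟨_, ha (a⁻¹ x), ?_⟩⟩
    simp

/-- The permutations commuting, at every point, with all far enough shifts by powers of `4`. -/
def recurrentPerms (G : Type*) [Group G] : Subgroup (Equiv.Perm (G × Multiplicative ℤ)) where
  carrier := {h | ∀ x, ∀ᶠ n : ℕ in Filter.atTop, h (x * shift G (4 ^ n)) = h x * shift G (4 ^ n)}
  one_mem' x := by simp
  mul_mem' {a b} ha hb x := by
    filter_upwards [ha (b x), hb x] with n hn hn'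
    simp [hn, hn']
  inv_mem' {a} ha x := by
    filter_upwards [ha (a⁻¹ x)] with n hn
    rw [Equiv.Perm.inv_eq_iff_eq, hn, Equiv.Perm.coe_inv, Equiv.apply_symm_apply]

theorem eq_one_of_mem_recurrentPerms {h : Equiv.Perm (G × Multiplicative ℤ)}
    (hh : h ∈ recurrentPerms G) (hfin : {x | h x ≠ x}.Finite) : h = 1 := by
  ext1 x
  by_contra hx
  have hinj : Function.Injective fun n : ℕ ↦ x * shift G (4 ^ n) := by
    intro m n hmn
    have h1 : (4 : ℤ) ^ m = 4 ^ n := by simpa [shift] using hmn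
    exact Int.pow_right_injective (by norm_num) h1
  have hev : ∀ᶠ n : ℕ in Filter.atTop, x * shift G (4 ^ n) ∉ {x | h x ≠ x} := by
    rw [← Nat.cofinite_eq_atTop]
    exact hinj.tendsto_cofinite.eventually hfin.eventually_cofinite_notMem
  obtain ⟨n, hn, hn'⟩ := (hev.and (hh x)).exists
  simp only [Set.mem_ofPred_eq, not_not, hn', mul_left_inj] at hn
  exact hx hn

theorem exists_abs_snd_le {G : Type*} {F : Set (G × Multiplicative ℤ)} (hF : F.Finite) :
    ∃ A : ℤ, ∀ f ∈ F, |f.2.toAdd| ≤ A := by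
  obtain ⟨A, hA⟩ := (hF.image fun f ↦ |f.2.toAdd|).bddAbove
  exact ⟨A, fun f hf ↦ hA ⟨f, hf, rfl⟩⟩

theorem eq_of_mem_nearTranslations {h : Equiv.Perm (G × Multiplicative ℤ)}
    {γ δ : G × Multiplicative ℤ} (hγ : (h, γ) ∈ nearTranslations G)
    (hδ : (h, δ) ∈ nearTranslations G) : γ = δ := by
  obtain ⟨F, hF, hγ⟩ := hγ
  obtain ⟨F', hF', hδ⟩ := hδ
  obtain ⟨A, hA⟩ := exists_abs_snd_le (hF.union hF')
  have hx : ∀ f ∈ F ∪ F', f⁻¹ * shift G (-A - 1) ∉ sparseSet G := by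
    intro f hf h
    have h1 := nonneg_of_mem_sparseInts h.2
    have h2 := neg_le_of_abs_le (hA f hf)
    simp only [shift, Prod.snd_mul, Prod.snd_inv, toAdd_mul, toAdd_inv, toAdd_ofAdd] at h1
    omega
  have h1 : h (shift G (-A - 1)) = γ * shift G (-A - 1) := by
    by_contra hne
    obtain ⟨f, hf, hfx⟩ := hγ _ hne
    exact hx f (.inl hf) hfx
  have h2 : h (shift G (-A - 1)) = δ * shift G (-A - 1) := by
    by_contra hne
    obtain ⟨f, hf, hfx⟩ := hδ _ hne
    exact hx f (.inr hf) hfx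
  exact mul_right_cancel (h1.symm.trans h2)

theorem pairSwap_mem_nearTranslations (g : G) : (pairSwap g, 1) ∈ nearTranslations G := by
  refine ⟨{1, (g, Multiplicative.ofAdd 1)}, Set.toFinite _, fun x hx ↦ ?_⟩
  by_contra! hx'
  refine hx ((pairSwap_apply_of_notMem g ?_ ?_).trans (one_mul x).symm)
  · simpa using hx' 1 (by simp)
  · exact hx' _ (by simp)

theorem pairSwap_mem_boundedDisplacement (g : G) :
    pairSwap g ∈ boundedDisplacement (G × Multiplicative ℤ) := by
  refine ⟨{1, (g, Multiplicative.ofAdd 1), (g, Multiplicative.ofAdd 1)⁻¹}, Set.toFinite _,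
    fun x ↦ ?_⟩
  by_cases h : x ∈ sparseSet G
  · rw [pairSwap_apply_of_mem g h, mul_inv_cancel_right]
    simp
  by_cases h' : (g, Multiplicative.ofAdd 1)⁻¹ * x ∈ sparseSet G
  · rw [pairSwap_apply_of_inv_mul_mem g h', mul_inv_cancel_right]
    simp
  · rw [pairSwap_apply_of_notMem g h h', mul_inv_cancel]
    simp

theorem pairSwap_mem_recurrentPerms (g : G) : pairSwap g ∈ recurrentPerms G := by
  intro x
  filter_upwards [eventually_mul_shift_mem_iff x,
    eventually_mul_shift_mem_iff ((g, Multiplicative.ofAdd 1)⁻¹ * x)] with n hn hn'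
  rw [mul_assoc] at hn'
  by_cases h : x ∈ sparseSet G
  · rw [pairSwap_apply_of_mem g h, pairSwap_apply_of_mem g (hn.2 h), mul_assoc]
  by_cases h' : (g, Multiplicative.ofAdd 1)⁻¹ * x ∈ sparseSet G
  · rw [pairSwap_apply_of_inv_mul_mem g h', pairSwap_apply_of_inv_mul_mem g (hn'.2 h'), mul_assoc]
  · rw [pairSwap_apply_of_notMem g h h',
      pairSwap_apply_of_notMem g (hn.not.2 h) (hn'.not.2 h')]

theorem toPermHom_mem_nearTranslations (γ : G × Multiplicative ℤ) :
    (MulAction.toPermHom _ _ γ, γ) ∈ nearTranslations G :=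
  ⟨∅, Set.finite_empty, fun _ hx ↦ (hx rfl).elim⟩

theorem toPermHom_mem_boundedDisplacement {Γ : Type*} [Group Γ] (γ : Γ) :
    MulAction.toPermHom Γ Γ γ ∈ boundedDisplacement Γ :=
  ⟨{γ}, Set.finite_singleton _, fun x ↦ by simp⟩

theorem toPermHom_mem_recurrentPerms (γ : G × Multiplicative ℤ) :
    MulAction.toPermHom _ _ γ ∈ recurrentPerms G :=
  fun _ ↦ .of_forall fun _ ↦ (mul_assoc _ _ _).symm

/-- Conjugating `pairSwap g` by a suitable translation isolates any one of its transpositions on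
a given finite set. -/
theorem swap_mem_pointwiseClosure [DecidableEq (G × Multiplicative ℤ)]
    {H : Subgroup (Equiv.Perm (G × Multiplicative ℤ))}
    (hH : ∀ γ : G × Multiplicative ℤ, MulAction.toPermHom _ _ γ ∈ H) {g : G} (hg : pairSwap g ∈ H)
    (x : G × Multiplicative ℤ) :
    Equiv.swap x (x * (g, Multiplicative.ofAdd 1)) ∈ pointwiseClosure H := by
  intro K hK
  set s : G × Multiplicative ℤ := (g, Multiplicative.ofAdd 1) with hs
  have hev : ∀ᶠ n : ℕ in Filter.atTop, ∀ z ∈ K,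
      (x⁻¹ * z ≠ 1 → x⁻¹ * z * shift G (2 * 4 ^ n) ∉ sparseSet G) ∧
      (s⁻¹ * (x⁻¹ * z) ≠ 1 → s⁻¹ * (x⁻¹ * z) * shift G (2 * 4 ^ n) ∉ sparseSet G) := by
    refine (Filter.eventually_all_finite hK).2 fun z _ ↦ Filter.Eventually.and ?_ ?_
    · exact Filter.eventually_imp_distrib_left.2 eventually_mul_shift_notMem
    · exact Filter.eventually_imp_distrib_left.2 eventually_mul_shift_notMem
  obtain ⟨n, hn⟩ := hev.exists
  set b := shift G (2 * 4 ^ n)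
  have hbS : b ∈ sparseSet G := ⟨rfl, two_mul_four_pow_mem_sparseInts n⟩
  have hcomm (y : G × Multiplicative ℤ) : b * y = y * b := (mul_shift_comm y _).symm
  let τ : Equiv.Perm (G × Multiplicative ℤ) := MulAction.toPermHom _ _ (x * b⁻¹)
  refine ⟨τ * pairSwap g * τ⁻¹,
    H.mul_mem (H.mul_mem (hH _) hg) (H.inv_mem (hH _)), fun z hz ↦ ?_⟩
  have happ : (τ * pairSwap g * τ⁻¹) z = x * b⁻¹ * pairSwap g (x⁻¹ * z * b) := by
    rw [← map_inv, Equiv.Perm.mul_apply, Equiv.Perm.mul_apply, ← hcomm]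
    simp [τ, mul_assoc]
  rw [happ]
  by_cases h1 : x⁻¹ * z = 1
  · obtain rfl : x = z := inv_mul_eq_one.1 h1
    rw [h1, one_mul, pairSwap_apply_of_mem g hbS, Equiv.swap_apply_left, ← hs, ← hcomm]
    group
  by_cases h2 : s⁻¹ * (x⁻¹ * z) = 1
  · obtain rfl : x * s = z := by rw [inv_mul_eq_one] at h2; rw [h2]; group
    rw [pairSwap_apply_of_inv_mul_mem g (by simpa [← hs] using hbS), Equiv.swap_apply_right, ← hs]
    group
  · rw [pairSwap_apply_of_notMem g ((hn z hz).1 h1)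
      (by simpa only [mul_assoc] using (hn z hz).2 h2), Equiv.swap_apply_of_ne_of_ne, ← hcomm]
    · group
    · rintro rfl
      simp at h1
    · rintro rfl
      simp at h2

theorem finite_of_nearTranslations {L : Subgroup (Equiv.Perm (G × Multiplicative ℤ))}
    (hL : L.FG) (hnear : ∀ h ∈ L, (h, 1) ∈ nearTranslations G)
    (hdisp : L ≤ boundedDisplacement (G × Multiplicative ℤ)) : Finite L := by
  obtain ⟨T, hT, hTfin⟩ := (Subgroup.fg_iff_submonoid_fg L).1 hL |> (Submonoid.fg_iff _).1
  have hTL : ∀ t ∈ T, t ∈ L := fun t ht ↦ by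
    have : t ∈ L.toSubmonoid := hT ▸ Submonoid.subset_closure ht
    exact this
  choose! F hF hF' using fun t ht ↦ hnear t (hTL t ht)
  choose! E hE hE' using fun t ht ↦ hdisp (hTL t ht)
  obtain ⟨A, hA⟩ := exists_abs_snd_le (hTfin.biUnion hF)
  obtain ⟨B, hB⟩ := exists_abs_snd_le (hTfin.biUnion hE)
  obtain ⟨j, hj⟩ := exists_ediv_eq_of_abs_sub_le (2 * A + B)
  set F₀ := ⋃ t ∈ T, F t
  have hmem : ∀ t ∈ T, ∀ x, t x ≠ x → ∃ f ∈ F₀, f⁻¹ * x ∈ sparseSet G := fun t ht x hx ↦ by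
    obtain ⟨f, hf, hfx⟩ := hF' t ht x (by simpa using hx)
    exact ⟨f, Set.mem_biUnion ht hf, hfx⟩
  have key : ∀ k ∈ Submonoid.closure T,
      (∀ x, (∀ f ∈ F₀, f⁻¹ * x ∉ sparseSet G) → k x = x) ∧
      ∀ x, ∀ f ∈ F₀, f⁻¹ * x ∈ sparseSet G → ∃ f' ∈ F₀, f'⁻¹ * k x ∈ sparseSet G ∧
        (f⁻¹ * x).2.toAdd / 4 ^ j = (f'⁻¹ * k x).2.toAdd / 4 ^ j := by
    intro k hk
    induction hk using Submonoid.closure_induction with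
    | one => exact ⟨fun _ _ ↦ rfl, fun x f hf hx ↦ ⟨f, hf, hx, rfl⟩⟩
    | mul k l _ _ hk hl =>
      refine ⟨fun x hx ↦ ?_, fun x f hf hx ↦ ?_⟩
      · rw [Equiv.Perm.mul_apply, hl.1 x hx, hk.1 x hx]
      · obtain ⟨f', hf', hx', h'⟩ := hl.2 x f hf hx
        obtain ⟨f'', hf'', hx'', h''⟩ := hk.2 (l x) f' hf' hx'
        exact ⟨f'', hf'', hx'', h'.trans h''⟩
    | mem t ht =>
      refine ⟨fun x hx ↦ ?_, fun x f hf hx ↦ ?_⟩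
      · by_contra h
        obtain ⟨f, hf, hfx⟩ := hmem t ht x h
        exact hx f hf hfx
      · by_cases h : t x = x
        · exact ⟨f, hf, by rwa [h], by rw [h]⟩
        · obtain ⟨f', hf', hx'⟩ := hmem t ht (t x) (fun h' ↦ h (t.injective h'))
          refine ⟨f', hf', hx', hj _ hx.2 _ hx'.2 ?_⟩
          have h1 := hA f hf
          have h2 := hA f' hf'
          have h3 := hB _ (Set.mem_biUnion ht (hE' t ht x))
          simp only [Prod.snd_mul, Prod.snd_inv, toAdd_mul, toAdd_inv] at h3 ⊢
          rw [abs_le] at *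
          constructor <;> linarith
  have hF₀fin : F₀.Finite := hTfin.biUnion hF
  let E₀ : Set (G × Multiplicative ℤ) := insert 1
    (Set.image2 (fun p d ↦ p.1 * shift G d * p.2⁻¹) (F₀ ×ˢ F₀) (Set.Icc (-4 ^ j) (4 ^ j)))
  have hE₀ : E₀.Finite := ((hF₀fin.prod hF₀fin).image2 _ (Set.finite_Icc _ _)).insert 1
  have horb : ∀ k ∈ L, ∀ x, k x * x⁻¹ ∈ E₀ := by
    intro k hk x
    obtain ⟨h1, h2⟩ := key k (by rw [hT]; exact hk)
    by_cases h : ∀ f ∈ F₀, f⁻¹ * x ∉ sparseSet G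
    · simp [h1 x h, E₀]
    · push Not at h
      obtain ⟨f, hf, hx⟩ := h
      obtain ⟨f', hf', hx', hq⟩ := h2 x f hf hx
      refine .inr ⟨(f', f), ⟨hf', hf⟩, (f'⁻¹ * k x).2.toAdd - (f⁻¹ * x).2.toAdd, ?_, ?_⟩
      · have hpos : (0 : ℤ) < 4 ^ j := by positivity
        have e1 := Int.emod_add_mul_ediv (f⁻¹ * x).2.toAdd (4 ^ j)
        have e2 := Int.emod_add_mul_ediv (f'⁻¹ * k x).2.toAdd (4 ^ j)
        have e3 := Int.emod_nonneg (f⁻¹ * x).2.toAdd hpos.ne'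
        have e4 := Int.emod_nonneg (f'⁻¹ * k x).2.toAdd hpos.ne'
        have e5 := Int.emod_lt_of_pos (f⁻¹ * x).2.toAdd hpos
        have e6 := Int.emod_lt_of_pos (f'⁻¹ * k x).2.toAdd hpos
        rw [hq] at e1
        constructor <;> linarith
      · have e : shift G ((f'⁻¹ * k x).2.toAdd - (f⁻¹ * x).2.toAdd) =
            (f'⁻¹ * k x) * (f⁻¹ * x)⁻¹ := by
          refine Prod.ext ?_ ?_
          · rw [Prod.fst_mul, Prod.fst_inv, hx.1, hx'.1]
            simp [shift]
          · rw [Prod.snd_mul, Prod.snd_inv]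
            simp [shift, div_eq_mul_inv]
        simp only [e]
        group
  have : Group.FG L := (Group.fg_iff_subgroup_fg L).2 hL
  have : Finite E₀ := hE₀
  refine finite_of_orbit_embeds (K := L) (X := G × Multiplicative ℤ) (E := E₀) fun x ↦
    ⟨fun y ↦ ⟨y.1 * x⁻¹, ?_⟩, fun y z h ↦ ?_⟩
  · obtain ⟨k, hk⟩ := y.2
    rw [← hk]
    exact horb k.1 k.2 x
  · exact Subtype.ext (mul_right_cancel (congrArg Subtype.val h))

theorem closure_oddShift_eq_top {A : Set G} (hA : Subgroup.closure A = ⊤) :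
    Subgroup.closure ((fun g : G ↦ (g, Multiplicative.ofAdd (1 : ℤ))) '' insert 1 A) = ⊤ := by
  set C := Subgroup.closure ((fun g : G ↦ (g, Multiplicative.ofAdd (1 : ℤ))) '' insert 1 A)
  have hmem : ∀ a ∈ insert 1 A, (a, Multiplicative.ofAdd (1 : ℤ)) ∈ C := fun a ha ↦
    Subgroup.subset_closure ⟨a, ha, rfl⟩
  have h1 := hmem 1 (by simp)
  have hG : ∀ g : G, (g, 1) ∈ C := by
    have : Subgroup.closure A ≤ C.comap (MonoidHom.inl G (Multiplicative ℤ)) := by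
      rw [Subgroup.closure_le]
      intro a ha
      simpa using C.mul_mem (hmem a (by simp [ha])) (C.inv_mem h1)
    intro g
    exact this (by simp [hA])
  refine eq_top_iff.2 fun x _ ↦ ?_
  have h := C.mul_mem (hG x.1) (C.zpow_mem h1 x.2.toAdd)
  convert h using 1
  refine Prod.ext (by simp) ?_
  simp [← ofAdd_zsmul]

end

/-- For every finitely generated group `G` there is a finitely generated group `H` with
`G ≤ H ≤ Sym(G × ℤ)` (where `G × ℤ` sits in `Sym(G × ℤ)` via left translations and `G` is
the first factor) such that: the natural action of `H` on `G × ℤ` is faithful and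
`k`-transitive for every `k`; `H` has a locally finite normal subgroup (a kernel) with
quotient isomorphic to `G × ℤ`; and the only finitely supported permutation in `H` is the
identity. -/
theorem statement1 (G : Type) [Group G] [Group.FG G] :
    ∃ H : Subgroup (Equiv.Perm (G × Multiplicative ℤ)),
      H.FG ∧
      (∀ g : G,
        MulAction.toPermHom (G × Multiplicative ℤ) (G × Multiplicative ℤ) (g, 1) ∈ H) ∧
      Function.Injective H.subtype ∧
      (∀ k : ℕ, IsKTransitive H.subtype k) ∧
      (∃ φ : H →* G × Multiplicative ℤ,
        Function.Surjective φ ∧ IsLocallyFinite φ.ker) ∧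
      (∀ π : Equiv.Perm (G × Multiplicative ℤ), π ∈ H →
        {x | π x ≠ x}.Finite → π = 1) := by
  classical
  obtain ⟨A, hA, hAfin⟩ := Group.fg_iff.1 ‹Group.FG G›
  set T : Set (G × Multiplicative ℤ) :=
    (fun g : G ↦ (g, Multiplicative.ofAdd (1 : ℤ))) '' insert 1 A
  have hT : Subgroup.closure T = ⊤ := closure_oddShift_eq_top hA
  set U : Set (Equiv.Perm (G × Multiplicative ℤ)) :=
    MulAction.toPermHom _ _ '' T ∪ pairSwap '' insert 1 A
  set H := Subgroup.closure U
  have htrans : ∀ γ : G × Multiplicative ℤ, MulAction.toPermHom _ _ γ ∈ H := by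
    have : Subgroup.closure T ≤ H.comap (MulAction.toPermHom _ _) :=
      (Subgroup.closure_le _).2 fun t ht ↦ Subgroup.subset_closure (.inl ⟨t, ht, rfl⟩)
    exact fun γ ↦ this (by simp [hT])
  have hswap : ∀ a ∈ insert 1 A, pairSwap a ∈ H := fun a ha ↦
    Subgroup.subset_closure (.inr ⟨a, ha, rfl⟩)
  have hdisp : H ≤ boundedDisplacement (G × Multiplicative ℤ) := by
    rw [Subgroup.closure_le]
    rintro _ (⟨t, -, rfl⟩ | ⟨a, -, rfl⟩)
    exacts [toPermHom_mem_boundedDisplacement t, pairSwap_mem_boundedDisplacement a]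
  have hrec : H ≤ recurrentPerms G := by
    rw [Subgroup.closure_le]
    rintro _ (⟨t, -, rfl⟩ | ⟨a, -, rfl⟩)
    exacts [toPermHom_mem_recurrentPerms t, pairSwap_mem_recurrentPerms a]
  have hnear : H ≤ (nearTranslations G).map (MonoidHom.fst _ _) := by
    rw [Subgroup.closure_le]
    rintro _ (⟨t, -, rfl⟩ | ⟨a, -, rfl⟩)
    exacts [⟨_, toPermHom_mem_nearTranslations t, rfl⟩, ⟨_, pairSwap_mem_nearTranslations a, rfl⟩]
  have hex : ∀ h : H, ∃ γ, (h.1, γ) ∈ nearTranslations G := by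
    rintro ⟨h, hh⟩
    obtain ⟨⟨_, γ⟩, hγ, rfl⟩ := hnear hh
    exact ⟨γ, hγ⟩
  choose φ hφ using hex
  let Φ : H →* G × Multiplicative ℤ := MonoidHom.mk' φ fun a b ↦
    eq_of_mem_nearTranslations (hφ (a * b)) ((nearTranslations G).mul_mem (hφ a) (hφ b))
  refine ⟨H, ?_, fun g ↦ htrans _, H.subtype_injective, ?_, ⟨Φ, fun γ ↦ ?_, fun K hK ↦ ?_⟩,
    fun π hπ hfin ↦ eq_one_of_mem_recurrentPerms (hrec hπ) hfin⟩
  · exact (Subgroup.fg_iff _).2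
      ⟨U, rfl, (((hAfin.insert 1).image _).image _).union ((hAfin.insert 1).image _)⟩
  · refine isKTransitive_of_swap_mem (swap_mem_of_swap_mul_mem hT _ ?_)
    rintro _ ⟨a, ha, rfl⟩ x
    exact swap_mem_pointwiseClosure htrans (hswap a ha) x
  · exact ⟨⟨_, htrans γ⟩,
      eq_of_mem_nearTranslations (hφ ⟨_, htrans γ⟩) (toPermHom_mem_nearTranslations γ)⟩
  · let ψ := H.subtype.comp Φ.ker.subtype
    have hψ : Function.Injective ψ := H.subtype_injective.comp Φ.ker.subtype_injective
    have : Finite (K.map ψ) := by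
      refine finite_of_nearTranslations ?_ ?_ ?_
      · exact (Subgroup.fg_iff_submonoid_fg _).2 (((Subgroup.fg_iff_submonoid_fg K).1 hK).map ψ)
      · rintro _ ⟨k, -, rfl⟩
        have h1 : φ k.1 = 1 := k.2
        exact h1 ▸ hφ k.1
      · rintro _ ⟨k, -, rfl⟩
        exact hdisp k.1.2
    exact Finite.of_equiv _ (K.equivMapOfInjective ψ hψ).symm.toEquiv
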